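/- Let K be a nonlocal vertex algebra. Then for all a, b ∈ K, Y(a, x₀+x₂)Y(b, x₂)1 = Y(Y(a,x₀)b, x₂)1 (without any multiplier (x₀+x₂)^l). Consequently, if K is non-degenerate, then the linear map Y(x): K⊗K → K((x)), a⊗b ↦ Y(a,x)b, is injective. -/

import Mathlib

open scoped TensorProduct BigOperators

noncomputable section

/-- Integer binomial coefficient `C(n, k)` for `n : ℤ`, `k : ℕ`. -/
def zchoose (n : ℤ) (k : ℕ) : ℤ :=
  if 0 ≤ n then ((n.toNat).choose k : ℤ)
  else (-1) ^ k * ((((k : ℤ) - n - 1).toNat).choose k)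

section Series

variable {V : Type*} [AddCommGroup V] [Module ℂ V]

/-- `a` is (the coefficient family of) an element of `V((x))`. -/
def IsLaurent (a : ℤ → V) : Prop := ∃ N : ℤ, ∀ n : ℤ, n < N → a n = 0

/-- `a` is an element of `V[[x]]`. -/
def IsPowerSeries (a : ℤ → V) : Prop := ∀ n : ℤ, n < 0 → a n = 0

/-- `A` is an element of `V((x₁, x₂))` (first index: exponent of `x₁`). -/
def IsLaurent2 (A : ℤ → ℤ → V) : Prop :=
  ∃ N : ℤ, ∀ m n : ℤ, (m < N ∨ n < N) → A m n = 0

/-- `a` is an element of `V ⊗ ℂ((x)) ⊆ V((x))`: truncated below, with coefficients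
lying in a finitely generated (i.e. finite dimensional) subspace. -/
def IsTensorLaurent (a : ℤ → V) : Prop :=
  IsLaurent a ∧ ∃ F : Submodule ℂ V, F.FG ∧ ∀ n, a n ∈ F

/-- Multiply the double series `A(x₁,x₂)` by `(x₁+x₂)^k`. -/
def mulAddPow (k : ℕ) (A : ℤ → ℤ → V) : ℤ → ℤ → V := fun a b =>
  ∑ j ∈ Finset.range (k + 1), ((k.choose j : ℕ) : ℂ) • A (a - (k : ℤ) + j) (b - j)

/-- Multiply the double series `A(x₁,x₂)` by `(x₁-x₂)^k`. -/
def mulSubPow (k : ℕ) (A : ℤ → ℤ → V) : ℤ → ℤ → V := fun a b =>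
  ∑ j ∈ Finset.range (k + 1),
    ((-1 : ℂ) ^ j * ((k.choose j : ℕ) : ℂ)) • A (a - (k : ℤ) + j) (b - j)

/-- Multiply the double series `A(x₁,x₂)` by `(x₂-x₁)^k`. -/
def mulSubPow' (k : ℕ) (A : ℤ → ℤ → V) : ℤ → ℤ → V := fun a b =>
  ∑ j ∈ Finset.range (k + 1),
    ((-1 : ℂ) ^ j * ((k.choose j : ℕ) : ℂ)) • A (a - j) (b - (k : ℤ) + j)

/-- Substitute `x₁ = x₀ + x₂` in `A(x₁,x₂)`, expanding in nonnegative powers of `x₂`.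
The result is indexed by (exponent of `x₀`, exponent of `x₂`). -/
def substAdd02 (A : ℤ → ℤ → V) : ℤ → ℤ → V := fun a b =>
  ∑ᶠ i : ℕ, ((zchoose (a + i) i : ℤ) : ℂ) • A (a + i) (b - i)

/-- Substitute `x₁ = x₂ + x₀` in `A(x₁,x₂)`, expanding in nonnegative powers of `x₀`.
The result is indexed by (exponent of `x₀`, exponent of `x₂`). -/
def substAdd20 (A : ℤ → ℤ → V) : ℤ → ℤ → V := fun a b =>
  if 0 ≤ a then ∑ᶠ m : ℤ, ((zchoose m a.toNat : ℤ) : ℂ) • A m (b - m + a) else 0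

/-- Multiply the double series `A(x₁,x₂)` by `f(x₂ - x₁)`, expanded in nonnegative
powers of `x₁`. -/
def scalarMulSub (f : ℤ → ℂ) (A : ℤ → ℤ → V) : ℤ → ℤ → V := fun m n =>
  ∑ᶠ (i : ℕ) (p : ℤ),
    ((-1 : ℂ) ^ i * ((zchoose p i : ℤ) : ℂ) * f p) • A (m - i) (n - p + i)

/-- Multiply a double series by a polynomial in two variables. -/
def polyMul2 (p : MvPolynomial (Fin 2) ℂ) (A : ℤ → ℤ → V) : ℤ → ℤ → V := fun m n =>
  ∑ d ∈ p.support, MvPolynomial.coeff d p • A (m - (d 0 : ℤ)) (n - (d 1 : ℤ))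

/-- The relation `A ∼ B`: `p·A = p·B` for some nonzero polynomial `p(x₁,x₂)`. -/
def SimEq2 (A B : ℤ → ℤ → V) : Prop :=
  ∃ p : MvPolynomial (Fin 2) ℂ, p ≠ 0 ∧ ∀ m n : ℤ, polyMul2 p A m n = polyMul2 p B m n

/-- `a` is an element of the iterated Laurent series space `V((x₁))⋯((x_n))`. -/
def IsIterLaurent : (n : ℕ) → ((Fin n → ℤ) → V) → Prop
  | 0, _ => True
  | n + 1, a =>
      (∃ N : ℤ, ∀ k : Fin (n + 1) → ℤ, k (Fin.last n) < N → a k = 0) ∧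
      ∀ m : ℤ, IsIterLaurent n fun k => a (Fin.snoc k m)

end Series

/-- A nonlocal vertex algebra over `ℂ`, with `Y u v n` the coefficient of `x^n`
in `Y(u,x)v` (so `u_m v = Y u v (-m-1)`). -/
structure NLVA (V : Type*) [AddCommGroup V] [Module ℂ V] where
  Y : V →ₗ[ℂ] V →ₗ[ℂ] (ℤ → V)
  one : V
  trunc : ∀ u v : V, IsLaurent (Y u v)
  vacuum_left : ∀ (v : V) (n : ℤ), Y one v n = if n = 0 then v else 0
  creation_reg : ∀ v : V, IsPowerSeries (Y v one)
  creation_zero : ∀ v : V, Y v one 0 = v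
  weak_assoc : ∀ u v w : V, ∃ k : ℕ, ∀ a b : ℤ,
    mulAddPow k (substAdd02 fun m n => Y u (Y v w n) m) a b
      = mulAddPow k (fun a' b' => Y (Y u v a') w b') a b

namespace NLVA

variable {U V K : Type*} [AddCommGroup U] [Module ℂ U] [AddCommGroup V] [Module ℂ V]
  [AddCommGroup K] [Module ℂ K]

/-- The coefficient `Y(·)_n(·)` as a bilinear map. -/
def Yc (𝒱 : NLVA V) (n : ℤ) : V →ₗ[ℂ] V →ₗ[ℂ] V :=
  𝒱.Y.compr₂ (LinearMap.proj n)

/-- The operator `D(v) = v_{-2}𝟙`, i.e. the coefficient of `x^1` in `Y(v,x)𝟙`. -/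
def D (𝒱 : NLVA V) : V →ₗ[ℂ] V :=
  (LinearMap.proj (1 : ℤ)).comp (𝒱.Y.flip 𝒱.one)

/-- Homomorphisms of nonlocal vertex algebras. -/
def IsHom (𝒰 : NLVA U) (𝒱 : NLVA V) (f : U →ₗ[ℂ] V) : Prop :=
  f 𝒰.one = 𝒱.one ∧ ∀ (a b : U) (n : ℤ), f (𝒰.Y a b n) = 𝒱.Y (f a) (f b) n

/-- `𝒦` is generated, as a nonlocal vertex algebra, by the subset `S`. -/
def IsGeneratedBy (𝒦 : NLVA K) (S : Set K) : Prop :=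
  ∀ P : Submodule ℂ K, 𝒦.one ∈ P →
    (∀ a ∈ P, ∀ b ∈ P, ∀ n : ℤ, 𝒦.Y a b n ∈ P) → S ⊆ P → P = ⊤

/-- `𝒰` is irreducible as a module over itself. -/
def SelfIrreducible (𝒰 : NLVA U) : Prop :=
  Nontrivial U ∧
    ∀ P : Submodule ℂ U, (∀ u : U, ∀ p ∈ P, ∀ n : ℤ, 𝒰.Y u p n ∈ P) → P = ⊥ ∨ P = ⊤

/-- The coefficients of the product `Y(v₁,x₁)⋯Y(v_n,x_n)𝟙`. -/
def prodY (𝒱 : NLVA V) : (n : ℕ) → (Fin n → V) → (Fin n → ℤ) → V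
  | 0, _, _ => 𝒱.one
  | n + 1, v, k => 𝒱.Y (v 0) (prodY 𝒱 n (fun i => v i.succ) fun i => k i.succ) (k 0)

/-- Non-degeneracy in the sense of Etingof–Kazhdan: the maps
`Z_n : V^{⊗n} ⊗ ℂ((x₁))⋯((x_n)) → V((x₁))⋯((x_n))` are injective. -/
def NonDegenerate (𝒱 : NLVA V) : Prop :=
  ∀ n : ℕ, 0 < n → ∀ (r : ℕ) (v : Fin r → Fin n → V) (f : Fin r → (Fin n → ℤ) → ℂ),
    (∀ j, IsIterLaurent n (f j)) →
    LinearIndependent ℂ (fun j : Fin r => PiTensorProduct.tprod ℂ (v j)) →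
    (∀ K' : Fin n → ℤ,
      (∑ j : Fin r, ∑ᶠ L : Fin n → ℤ,
        f j L • 𝒱.prodY n (v j) fun i => K' i - L i) = 0) →
    ∀ j, f j = 0

end NLVA

/-- Countable dimension over `ℂ`. -/
def CountableDim (U : Type*) [AddCommGroup U] [Module ℂ U] : Prop :=
  ∃ s : Set U, s.Countable ∧ Submodule.span ℂ s = ⊤

/-- `𝒱` satisfies `𝒮`-locality, i.e. is a weak quantum vertex algebra. -/
def SLocal {V : Type*} [AddCommGroup V] [Module ℂ V] (𝒱 : NLVA V) : Prop :=
  ∀ u v : V, ∃ (r : ℕ) (uu vv : Fin r → V) (f : Fin r → ℤ → ℂ) (k : ℕ),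
    (∀ i, IsLaurent (f i)) ∧ ∀ (w : V) (m n : ℤ),
      mulSubPow k (fun a b => 𝒱.Y u (𝒱.Y v w b) a) m n
        = mulSubPow k (fun a b => ∑ i, scalarMulSub (f i)
            (fun a' b' => 𝒱.Y (vv i) (𝒱.Y (uu i) w a') b') a b) m n

/-- A module for a nonlocal vertex algebra. -/
structure NLVAModule {V : Type*} [AddCommGroup V] [Module ℂ V] (𝒱 : NLVA V)
    (W : Type*) [AddCommGroup W] [Module ℂ W] where
  Yw : V →ₗ[ℂ] W →ₗ[ℂ] (ℤ → W)
  trunc : ∀ (v : V) (w : W), IsLaurent (Yw v w)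
  vacuum : ∀ (w : W) (n : ℤ), Yw 𝒱.one w n = if n = 0 then w else 0
  weak_assoc : ∀ (u v : V) (w : W), ∃ k : ℕ, ∀ a b : ℤ,
    mulAddPow k (substAdd02 fun m n => Yw u (Yw v w n) m) a b
      = mulAddPow k (fun a' b' => Yw (𝒱.Y u v a') w b') a b

section Twist

variable {U V : Type*} [AddCommGroup U] [Module ℂ U] [AddCommGroup V] [Module ℂ V]

/-- Coefficient of `x₁^m x₂^n` in `(Y(x₂)⊗1)R²³(x₁)R¹²(x₁+x₂)` applied to `v ⊗ u ⊗ u'`. -/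
def hex1RHS (𝒰 : NLVA U) (Rc : ℤ → (V ⊗[ℂ] U →ₗ[ℂ] U ⊗[ℂ] V))
    (v : V) (u u' : U) (m n : ℤ) : U ⊗[ℂ] V :=
  ∑ᶠ (i : ℕ) (c : ℤ),
    ((zchoose (m - c + i) i : ℤ) : ℂ) •
      (TensorProduct.map (TensorProduct.lift (𝒰.Yc (n - i))) LinearMap.id)
        ((TensorProduct.assoc ℂ U U V).symm
          ((LinearMap.lTensor U (Rc c))
            ((TensorProduct.assoc ℂ U V U)
              ((Rc (m - c + i) (v ⊗ₜ u)) ⊗ₜ u'))))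

/-- Coefficient of `x₁^m x₂^n` in `(1⊗Y(x₂))R¹²(x₁-x₂)R²³(x₁)` applied to `v ⊗ v' ⊗ u`. -/
def hex2RHS (𝒱 : NLVA V) (Rc : ℤ → (V ⊗[ℂ] U →ₗ[ℂ] U ⊗[ℂ] V))
    (v v' : V) (u : U) (m n : ℤ) : U ⊗[ℂ] V :=
  ∑ᶠ (i : ℕ) (c : ℤ),
    ((-1 : ℂ) ^ i * ((zchoose (m - c + i) i : ℤ) : ℂ)) •
      (LinearMap.lTensor U (TensorProduct.lift (𝒱.Yc (n - i))))
        ((TensorProduct.assoc ℂ U V V)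
          ((TensorProduct.map (Rc (m - c + i)) LinearMap.id)
            ((TensorProduct.assoc ℂ V U V).symm
              (v ⊗ₜ (Rc c (v' ⊗ₜ u))))))

/-- A twisting operator `R(x) : V ⊗ U → U ⊗ V ⊗ ℂ((x))` for the ordered pair `(U,V)`,
given by its family of coefficients `Rc n`. -/
structure TwistingOp (𝒰 : NLVA U) (𝒱 : NLVA V) where
  Rc : ℤ → (V ⊗[ℂ] U →ₗ[ℂ] U ⊗[ℂ] V)
  laurent : ∀ t : V ⊗[ℂ] U, IsTensorLaurent fun n => Rc n t
  vac_right : ∀ (v : V) (n : ℤ),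
    Rc n (v ⊗ₜ 𝒰.one) = if n = 0 then 𝒰.one ⊗ₜ v else 0
  vac_left : ∀ (u : U) (n : ℤ),
    Rc n (𝒱.one ⊗ₜ u) = if n = 0 then u ⊗ₜ 𝒱.one else 0
  hex1 : ∀ (v : V) (u u' : U) (m n : ℤ),
    Rc m (v ⊗ₜ (𝒰.Y u u' n)) = hex1RHS 𝒰 Rc v u u' m n
  hex2 : ∀ (v v' : V) (u : U) (m n : ℤ),
    Rc m ((𝒱.Y v v' n) ⊗ₜ u) = hex2RHS 𝒱 Rc v v' u m n

/-- `Sc` is a two-sided inverse of `Rc` as `ℂ((x))`-linear maps (coefficientwise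
convolution), with values in the tensor with `ℂ((x))`. -/
def IsInvPair {A B : Type*} [AddCommGroup A] [Module ℂ A] [AddCommGroup B] [Module ℂ B]
    (Rc : ℤ → (A →ₗ[ℂ] B)) (Sc : ℤ → (B →ₗ[ℂ] A)) : Prop :=
  (∀ t : B, IsTensorLaurent fun n => Sc n t) ∧
  (∀ (t : A) (n : ℤ), (∑ᶠ c : ℤ, Sc c (Rc (n - c) t)) = if n = 0 then t else 0) ∧
  (∀ (t : B) (n : ℤ), (∑ᶠ c : ℤ, Rc c (Sc (n - c) t)) = if n = 0 then t else 0)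

/-- The canonical embedding `u ↦ u ⊗ 𝟙`. -/
def iotaU (𝒱 : NLVA V) : U →ₗ[ℂ] U ⊗[ℂ] V := (TensorProduct.mk ℂ U V).flip 𝒱.one

/-- The canonical embedding `v ↦ 𝟙 ⊗ v`. -/
def iotaV (𝒰 : NLVA U) : V →ₗ[ℂ] U ⊗[ℂ] V := TensorProduct.mk ℂ U V 𝒰.one

/-- The operator `D ⊗ 1 + 1 ⊗ D` on `U ⊗ V`. -/
def DUV (𝒰 : NLVA U) (𝒱 : NLVA V) : U ⊗[ℂ] V →ₗ[ℂ] U ⊗[ℂ] V :=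
  LinearMap.rTensor V 𝒰.D + LinearMap.lTensor U 𝒱.D

/-- The coefficient of `x^n` in `Y_R(u⊗v, x)(u'⊗v') = (Y(x)⊗Y(x))R²³(-x)(u⊗v⊗u'⊗v')`. -/
def YRcoef (𝒰 : NLVA U) (𝒱 : NLVA V) (Rop : TwistingOp 𝒰 𝒱)
    (u : U) (v : V) (u' : U) (v' : V) (n : ℤ) : U ⊗[ℂ] V :=
  ∑ᶠ (c : ℤ) (a : ℤ),
    ((-1 : ℂ) ^ c) •
      (TensorProduct.map (𝒰.Yc a u) ((𝒱.Yc (n - c - a)).flip v'))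
        (Rop.Rc c (v ⊗ₜ u'))

/-- `𝒯` is the twisted tensor product nonlocal vertex algebra `U ⊗_R V`. -/
def IsTwistedTensor (𝒰 : NLVA U) (𝒱 : NLVA V) (Rop : TwistingOp 𝒰 𝒱)
    (𝒯 : NLVA (U ⊗[ℂ] V)) : Prop :=
  𝒯.one = 𝒰.one ⊗ₜ 𝒱.one ∧
  ∀ (u u' : U) (v v' : V) (n : ℤ),
    𝒯.Y (u ⊗ₜ v) (u' ⊗ₜ v') n = YRcoef 𝒰 𝒱 Rop u v u' v' n

end Twist

section Aux

variable {A B W T : Type*} [AddCommGroup A] [Module ℂ A] [AddCommGroup B] [Module ℂ B]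
  [AddCommGroup W] [Module ℂ W] [AddCommGroup T] [Module ℂ T]

/-- The linear map `(a ⊗ b) ↦ Y_A(a)_e (Y_B(b)_j w)`, i.e. the coefficient
of `Y_A(x₂)(1 ⊗ Y_B(x₁)) (· ⊗ · ⊗ w)` at `x₂^e x₁^j`. -/
def sandwichMod (YA : A →ₗ[ℂ] W →ₗ[ℂ] (ℤ → W)) (YB : B →ₗ[ℂ] W →ₗ[ℂ] (ℤ → W))
    (w : W) (e j : ℤ) : A ⊗[ℂ] B →ₗ[ℂ] W :=
  TensorProduct.lift
    ((YA.compr₂ (LinearMap.proj e)).compl₂ ((YB.compr₂ (LinearMap.proj j)).flip w))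

/-- Coefficient of `x₁^m x₂^n` in `Y_A(x₂)(1 ⊗ Y_B(x₁)) q(x₂ - x₁) (⋯ ⊗ w)`, where the
series `q` is evaluated at `x₂ - x₁`, expanded in nonnegative powers of `x₁`. -/
def twistRHS (YA : A →ₗ[ℂ] W →ₗ[ℂ] (ℤ → W)) (YB : B →ₗ[ℂ] W →ₗ[ℂ] (ℤ → W))
    (q : ℤ → A ⊗[ℂ] B) (w : W) : ℤ → ℤ → W := fun m n =>
  ∑ᶠ (i : ℕ) (p : ℤ),
    ((-1 : ℂ) ^ i * ((zchoose p i : ℤ) : ℂ)) •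
      sandwichMod YA YB w (n - p + i) (m - i) (q p)

/-- As `twistRHS`, but with `q` evaluated at `-x₂ + x₁`, expanded in nonnegative
powers of `x₂`. -/
def twistRHSalt (YA : A →ₗ[ℂ] W →ₗ[ℂ] (ℤ → W)) (YB : B →ₗ[ℂ] W →ₗ[ℂ] (ℤ → W))
    (q : ℤ → A ⊗[ℂ] B) (w : W) : ℤ → ℤ → W := fun m n =>
  ∑ᶠ (i : ℕ) (p : ℤ),
    ((-1 : ℂ) ^ i * ((zchoose p i : ℤ) : ℂ)) •
      sandwichMod YA YB w (n - i) (m - p + i) (q p)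

/-- Coefficient of `x^n` in `e^{xD} F(x)` where `F` is given by its coefficients. -/
def expD (Dop : T →ₗ[ℂ] T) (F : ℤ → T) (n : ℤ) : T :=
  ∑ᶠ j : ℕ, ((j.factorial : ℂ))⁻¹ • (Dop ^ j) (F (n - j))

end Aux

section YBE

variable {V : Type*} [AddCommGroup V] [Module ℂ V]

/-- The flip of the last two tensor factors of `(V⊗V)⊗V`. -/
def swap23 : (V ⊗[ℂ] V) ⊗[ℂ] V →ₗ[ℂ] (V ⊗[ℂ] V) ⊗[ℂ] V :=
  ((TensorProduct.assoc ℂ V V V).symm.toLinearMap).comp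
    ((LinearMap.lTensor V (TensorProduct.comm ℂ V V).toLinearMap).comp
      (TensorProduct.assoc ℂ V V V).toLinearMap)

/-- `S¹²` acting on `(V⊗V)⊗V`. -/
def S12m (Sc : ℤ → (V ⊗[ℂ] V →ₗ[ℂ] V ⊗[ℂ] V)) (c : ℤ) :
    (V ⊗[ℂ] V) ⊗[ℂ] V →ₗ[ℂ] (V ⊗[ℂ] V) ⊗[ℂ] V :=
  TensorProduct.map (Sc c) LinearMap.id

/-- `S²³` acting on `(V⊗V)⊗V`. -/
def S23m (Sc : ℤ → (V ⊗[ℂ] V →ₗ[ℂ] V ⊗[ℂ] V)) (c : ℤ) :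
    (V ⊗[ℂ] V) ⊗[ℂ] V →ₗ[ℂ] (V ⊗[ℂ] V) ⊗[ℂ] V :=
  ((TensorProduct.assoc ℂ V V V).symm.toLinearMap).comp
    ((LinearMap.lTensor V (Sc c)).comp (TensorProduct.assoc ℂ V V V).toLinearMap)

/-- `S¹³` acting on `(V⊗V)⊗V`. -/
def S13m (Sc : ℤ → (V ⊗[ℂ] V →ₗ[ℂ] V ⊗[ℂ] V)) (c : ℤ) :
    (V ⊗[ℂ] V) ⊗[ℂ] V →ₗ[ℂ] (V ⊗[ℂ] V) ⊗[ℂ] V :=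
  swap23.comp ((S12m Sc c).comp swap23)

/-- `S²¹(x) = σ S(x) σ`. -/
def S21c (Sc : ℤ → (V ⊗[ℂ] V →ₗ[ℂ] V ⊗[ℂ] V)) (c : ℤ) :
    V ⊗[ℂ] V →ₗ[ℂ] V ⊗[ℂ] V :=
  ((TensorProduct.comm ℂ V V).toLinearMap).comp
    ((Sc c).comp (TensorProduct.comm ℂ V V).toLinearMap)

/-- The quantum Yang–Baxter equation
`S¹²(x)S¹³(x+z)S²³(z) = S²³(z)S¹³(x+z)S¹²(x)` (coefficient of `x^a z^b`, with
`S¹³(x+z)` expanded in nonnegative powers of `z`). -/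
def QYBE (Sc : ℤ → (V ⊗[ℂ] V →ₗ[ℂ] V ⊗[ℂ] V)) : Prop :=
  ∀ (t : (V ⊗[ℂ] V) ⊗[ℂ] V) (a b : ℤ),
    (∑ᶠ (i : ℕ) (p : ℤ), ((zchoose p i : ℤ) : ℂ) •
        S12m Sc (a - p + i) (S13m Sc p (S23m Sc (b - i) t)))
      = ∑ᶠ (i : ℕ) (p : ℤ), ((zchoose p i : ℤ) : ℂ) •
          S23m Sc (b - i) (S13m Sc p (S12m Sc (a - p + i) t))

/-- Unitarity: `S(x) S²¹(-x) = 1`. -/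
def Unitary (Sc : ℤ → (V ⊗[ℂ] V →ₗ[ℂ] V ⊗[ℂ] V)) : Prop :=
  ∀ (t : V ⊗[ℂ] V) (n : ℤ),
    (∑ᶠ c : ℤ, ((-1 : ℂ) ^ (n - c)) • Sc c (S21c Sc (n - c) t))
      = if n = 0 then t else 0

/-- `[D ⊗ 1, S(x)] = -(d/dx) S(x)`. -/
def DComm1 (𝒱 : NLVA V) (Sc : ℤ → (V ⊗[ℂ] V →ₗ[ℂ] V ⊗[ℂ] V)) : Prop :=
  ∀ (t : V ⊗[ℂ] V) (n : ℤ),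
    (LinearMap.rTensor V 𝒱.D) (Sc n t) - Sc n ((LinearMap.rTensor V 𝒱.D) t)
      = (-((n : ℂ) + 1)) • Sc (n + 1) t

/-- `Y(u,x)v = e^{xD} Y(-x) S(-x)(v⊗u)`. -/
def SkewS (𝒱 : NLVA V) (Sc : ℤ → (V ⊗[ℂ] V →ₗ[ℂ] V ⊗[ℂ] V)) : Prop :=
  ∀ (u v : V) (n : ℤ),
    𝒱.Y u v n = expD 𝒱.D (fun p => ((-1 : ℂ) ^ p) •
      ∑ᶠ c : ℤ, (TensorProduct.lift (𝒱.Yc (p - c))) (Sc c (v ⊗ₜ u))) n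

/-- `S(x₁)(Y(x₂)⊗1) = (Y(x₂)⊗1)S²³(x₁)S¹³(x₁+x₂)`. -/
def HexY1 (𝒱 : NLVA V) (Sc : ℤ → (V ⊗[ℂ] V →ₗ[ℂ] V ⊗[ℂ] V)) : Prop :=
  ∀ (t : (V ⊗[ℂ] V) ⊗[ℂ] V) (m n : ℤ),
    Sc m ((TensorProduct.map (TensorProduct.lift (𝒱.Yc n)) LinearMap.id) t)
      = ∑ᶠ (i : ℕ) (p : ℤ), ((zchoose p i : ℤ) : ℂ) •
          (TensorProduct.map (TensorProduct.lift (𝒱.Yc (n - i))) LinearMap.id)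
            (S23m Sc (m - p + i) (S13m Sc p t))

/-- `S(x₁)(1⊗Y(x₂)) = (1⊗Y(x₂))S¹²(x₁-x₂)S¹³(x₁)`. -/
def HexY2 (𝒱 : NLVA V) (Sc : ℤ → (V ⊗[ℂ] V →ₗ[ℂ] V ⊗[ℂ] V)) : Prop :=
  ∀ (t : (V ⊗[ℂ] V) ⊗[ℂ] V) (m n : ℤ),
    Sc m ((LinearMap.lTensor V (TensorProduct.lift (𝒱.Yc n)))
        ((TensorProduct.assoc ℂ V V V) t))
      = ∑ᶠ (i : ℕ) (p : ℤ), ((-1 : ℂ) ^ i * ((zchoose p i : ℤ) : ℂ)) •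
          (LinearMap.lTensor V (TensorProduct.lift (𝒱.Yc (n - i))))
            ((TensorProduct.assoc ℂ V V V)
              (S12m Sc p (S13m Sc (m - p + i) t)))

/-- A quantum vertex algebra `(V, 𝒮)`. -/
structure QVA (V : Type*) [AddCommGroup V] [Module ℂ V] where
  alg : NLVA V
  sloc : SLocal alg
  Sc : ℤ → (V ⊗[ℂ] V →ₗ[ℂ] V ⊗[ℂ] V)
  laurent : ∀ t : V ⊗[ℂ] V, IsTensorLaurent fun n => Sc n t
  qybe : QYBE Sc
  unitary : Unitary Sc
  vac : ∀ (v : V) (n : ℤ), Sc n (alg.one ⊗ₜ v) = if n = 0 then alg.one ⊗ₜ v else 0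
  dcomm : DComm1 alg Sc
  skew : SkewS alg Sc
  hex : HexY1 alg Sc

end YBE

section Bialg

variable {H : Type*} [AddCommGroup H] [Module ℂ H]

/-- A nonlocal vertex bialgebra. -/
structure NLVBialg (H : Type*) [AddCommGroup H] [Module ℂ H] where
  alg : NLVA H
  comul : H →ₗ[ℂ] H ⊗[ℂ] H
  counit : H →ₗ[ℂ] ℂ
  coassoc : ∀ h : H, (LinearMap.lTensor H comul) (comul h)
      = (TensorProduct.assoc ℂ H H H) ((LinearMap.rTensor H comul) (comul h))
  counit_comul_left : ∀ h : H,
      (TensorProduct.lid ℂ H) ((LinearMap.rTensor H counit) (comul h)) = h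
  counit_comul_right : ∀ h : H,
      (TensorProduct.rid ℂ H) ((LinearMap.lTensor H counit) (comul h)) = h
  counit_one : counit alg.one = 1
  counit_mul : ∀ (a b : H) (n : ℤ),
      counit (alg.Y a b n) = if n = 0 then counit a * counit b else 0
  comul_one : comul alg.one = alg.one ⊗ₜ alg.one
  comul_mul : ∀ (a b : H) (n : ℤ),
      comul (alg.Y a b n)
        = ∑ᶠ p : ℤ, (TensorProduct.map₂ (alg.Yc p) (alg.Yc (n - p))) (comul a) (comul b)

/-- A nonlocal vertex `H`-module-algebra. -/
structure NLVModAlg (𝓗 : NLVBialg H) (U : Type*) [AddCommGroup U] [Module ℂ U] where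
  alg : NLVA U
  act : NLVAModule 𝓗.alg U
  scalar : ∀ (h : H) (u : U), IsTensorLaurent fun n => act.Yw h u n
  vac : ∀ (h : H) (n : ℤ),
      act.Yw h alg.one n = if n = 0 then 𝓗.counit h • alg.one else 0
  compat : ∀ (h : H) (u v : U) (m n : ℤ),
      act.Yw h (alg.Y u v n) m
        = ∑ᶠ (i : ℕ) (p : ℤ), ((-1 : ℂ) ^ i * ((zchoose p i : ℤ) : ℂ)) •
            (TensorProduct.lift
              (((alg.Yc (n - i)).comp ((act.Yw.compr₂ (LinearMap.proj p)).flip u)).compl₂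
                ((act.Yw.compr₂ (LinearMap.proj (m - p + i))).flip v)))
            (𝓗.comul h)

/-- A nonlocal vertex `H`-comodule-algebra. -/
structure NLVComodAlg (𝓗 : NLVBialg H) (V : Type*) [AddCommGroup V] [Module ℂ V] where
  alg : NLVA V
  rho : V →ₗ[ℂ] H ⊗[ℂ] V
  coassoc : ∀ v : V, (LinearMap.lTensor H rho) (rho v)
      = (TensorProduct.assoc ℂ H H V) ((LinearMap.rTensor V 𝓗.comul) (rho v))
  counit_rho : ∀ v : V,
      (TensorProduct.lid ℂ V) ((LinearMap.rTensor V 𝓗.counit) (rho v)) = v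
  rho_one : rho alg.one = 𝓗.alg.one ⊗ₜ alg.one
  rho_mul : ∀ (v v' : V) (n : ℤ),
      rho (alg.Y v v' n)
        = ∑ᶠ p : ℤ, (TensorProduct.map₂ (𝓗.alg.Yc p) (alg.Yc (n - p))) (rho v) (rho v')

/-- The coefficient of `x^n` in
`Y_♯(u⊗v, x)(u'⊗v') = Y(u,x)Y(b¹(v),x)u' ⊗ Y(v²,x)v'`. -/
def Ysharp (𝓗 : NLVBialg H) {U V : Type*} [AddCommGroup U] [Module ℂ U]
    [AddCommGroup V] [Module ℂ V] (MU : NLVModAlg 𝓗 U) (CV : NLVComodAlg 𝓗 V)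
    (u : U) (v : V) (u' : U) (v' : V) (n : ℤ) : U ⊗[ℂ] V :=
  ∑ᶠ (a : ℤ) (p : ℤ),
    (TensorProduct.map
      ((MU.alg.Yc a u).comp ((MU.act.Yw.compr₂ (LinearMap.proj p)).flip u'))
      ((CV.alg.Yc (n - a - p)).flip v'))
    (CV.rho v)

/-- Rearrangement `(H⊗V)⊗U → (H⊗U)⊗V`. -/
def smashSwap {U V : Type*} [AddCommGroup U] [Module ℂ U]
    [AddCommGroup V] [Module ℂ V] :
    (H ⊗[ℂ] V) ⊗[ℂ] U →ₗ[ℂ] (H ⊗[ℂ] U) ⊗[ℂ] V :=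
  ((TensorProduct.assoc ℂ H U V).symm.toLinearMap).comp
    ((LinearMap.lTensor H (TensorProduct.comm ℂ V U).toLinearMap).comp
      (TensorProduct.assoc ℂ H V U).toLinearMap)

/-- The coefficient of `x^n` in `R(x)(v⊗u) = Y(b¹(v),-x)u ⊗ v²`. -/
def Rsmash (𝓗 : NLVBialg H) {U V : Type*} [AddCommGroup U] [Module ℂ U]
    [AddCommGroup V] [Module ℂ V] (MU : NLVModAlg 𝓗 U) (CV : NLVComodAlg 𝓗 V)
    (n : ℤ) : V ⊗[ℂ] U →ₗ[ℂ] U ⊗[ℂ] V :=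
  ((-1 : ℂ) ^ n) •
    ((TensorProduct.map
        (TensorProduct.lift (MU.act.Yw.compr₂ (LinearMap.proj n))) LinearMap.id).comp
      (smashSwap.comp (LinearMap.rTensor U CV.rho)))

end Bialg

section SeriesLemmas

variable {V : Type*} [AddCommGroup V] [Module ℂ V]

lemma zchoose_zero_right (n : ℤ) : zchoose n 0 = 1 := by
  simp [zchoose]

/-- Multiplication by `(x₁+x₂)^k` is injective on double series that are power series in `x₂`. -/
lemma eq_of_mulAddPow_eq {k : ℕ} {A B : ℤ → ℤ → V}
    (hA : ∀ m n, n < 0 → A m n = 0) (hB : ∀ m n, n < 0 → B m n = 0)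
    (h : ∀ m n, mulAddPow k A m n = mulAddPow k B m n) (m n : ℤ) : A m n = B m n := by
  have key : ∀ (N : ℕ) (n : ℤ), n < N → ∀ m, A m n = B m n := by
    intro N
    induction N with
    | zero => intro n hn m; rw [hA m n (by simpa using hn), hB m n (by simpa using hn)]
    | succ N ih =>
      intro n hn m
      have h' := h (m + k) n
      simp only [mulAddPow, Finset.sum_range_succ'] at h'
      have hs : ∀ j ∈ Finset.range k,
          ((k.choose (j + 1) : ℕ) : ℂ) • A (m + k - k + ((j + 1 : ℕ) : ℤ)) (n - ((j + 1 : ℕ) : ℤ))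
          = ((k.choose (j + 1) : ℕ) : ℂ) •
            B (m + k - k + ((j + 1 : ℕ) : ℤ)) (n - ((j + 1 : ℕ) : ℤ)) := by
        intro j _
        rw [ih _ (by push_cast at hn ⊢; omega)]
      rw [Finset.sum_congr rfl hs] at h'
      simpa using h'
  exact key (n.toNat + 1) n (by omega) m

lemma substAdd02_eq_sum {A : ℤ → ℤ → V} (hA : ∀ m n, n < 0 → A m n = 0) (a b : ℤ) {N : ℕ}
    (hN : b < N) :
    substAdd02 A a b
      = ∑ i ∈ Finset.range N, ((zchoose (a + i) i : ℤ) : ℂ) • A (a + i) (b - i) := by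
  refine finsum_eq_sum_of_support_subset _ fun i hi => ?_
  by_contra hiN
  refine hi ?_
  beta_reduce
  rw [hA _ _ (by simp at hiN; omega), smul_zero]

lemma substAdd02_of_neg {A : ℤ → ℤ → V} (hA : ∀ m n, n < 0 → A m n = 0) (a b : ℤ) (hb : b < 0) :
    substAdd02 A a b = 0 := by
  simp [substAdd02_eq_sum hA a b (N := 0) (by simpa using hb)]

/-- The substitution `x₁ = x₀ + x₂` is injective on double series that are power series
in `x₂`. -/
lemma eq_zero_of_substAdd02_eq_zero {A : ℤ → ℤ → V} (hA : ∀ m n, n < 0 → A m n = 0)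
    (h : ∀ m n, substAdd02 A m n = 0) (m n : ℤ) : A m n = 0 := by
  have key : ∀ (N : ℕ) (n : ℤ), n < N → ∀ m, A m n = 0 := by
    intro N
    induction N with
    | zero => intro n hn m; exact hA m n (by simpa using hn)
    | succ N ih =>
      intro n hn m
      have h' := h m n
      rw [substAdd02_eq_sum hA m n hn, Finset.sum_range_succ', Finset.sum_eq_zero] at h'
      · simpa [zchoose_zero_right] using h'
      · intro i _
        rw [ih _ (by push_cast at hn ⊢; omega), smul_zero]
  exact key (n.toNat + 1) n (by omega) m

lemma substAdd02_sum_smul {ι : Type*} (s : Finset ι) (c : ι → ℂ) {A : ι → ℤ → ℤ → V}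
    (hA : ∀ j m n, n < 0 → A j m n = 0) (a b : ℤ) :
    substAdd02 (fun m n => ∑ j ∈ s, c j • A j m n) a b
      = ∑ j ∈ s, c j • substAdd02 (A j) a b := by
  have hN : b < ((b.toNat + 1 : ℕ) : ℤ) := by omega
  rw [substAdd02_eq_sum (fun m n hn => Finset.sum_eq_zero fun j _ => by
    rw [hA j m n hn, smul_zero]) a b hN]
  simp_rw [fun j => substAdd02_eq_sum (hA j) a b hN, Finset.smul_sum]
  rw [Finset.sum_comm]
  exact Finset.sum_congr rfl fun j _ => Finset.sum_congr rfl fun i _ => smul_comm _ _ _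

end SeriesLemmas

lemma isIterLaurent_two_single (c : ℂ) :
    IsIterLaurent 2 (Pi.single (0 : Fin 2 → ℤ) c) := by
  refine ⟨⟨0, fun k hk => Pi.single_eq_of_ne ?_ _⟩, fun m => ⟨⟨0, fun k hk =>
    Pi.single_eq_of_ne ?_ _⟩, fun _ => trivial⟩⟩
  · rintro rfl
    simp at hk
  · intro h
    have h0 := congrFun h (Fin.castSucc (Fin.last 0))
    rw [Fin.snoc_castSucc] at h0
    simp_all

/-- The pure tensor `v 0 ⊗ v 1` as a multilinear map. -/
def tmulMultilinear (V : Type*) [AddCommGroup V] [Module ℂ V] :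
    MultilinearMap ℂ (fun _ : Fin 2 => V) (V ⊗[ℂ] V) where
  toFun v := v 0 ⊗ₜ v 1
  map_update_add' v i x y := by
    fin_cases i <;> simp [TensorProduct.add_tmul, TensorProduct.tmul_add]
  map_update_smul' v i c x := by
    fin_cases i <;> simp [TensorProduct.smul_tmul']

/-- Linear independence of pure tensors passes from `V ⊗ V` to `⨂[ℂ] _ : Fin 2, V`. -/
lemma linearIndependent_tprod_pair {V ι : Type*} [AddCommGroup V] [Module ℂ V] {a b : ι → V}
    (h : LinearIndependent ℂ fun j => a j ⊗ₜ[ℂ] b j) :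
    LinearIndependent ℂ fun j => PiTensorProduct.tprod ℂ ![a j, b j] := by
  exact LinearIndependent.of_comp (PiTensorProduct.lift (tmulMultilinear V)) <| by
    simpa [Function.comp_def, tmulMultilinear] using h

namespace NLVA

variable {K : Type*} [AddCommGroup K] [Module ℂ K] (𝒦 : NLVA K)

lemma Y_Y_one_of_neg (a b : K) (m n : ℤ) (hn : n < 0) :
    𝒦.Y a (𝒦.Y b 𝒦.one n) m = 0 := by
  simp [𝒦.creation_reg b n hn]

/-- Weak associativity on the vacuum holds without a multiplier. -/
lemma assoc_one (a b : K) (i j : ℤ) :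
    substAdd02 (fun m n => 𝒦.Y a (𝒦.Y b 𝒦.one n) m) i j = 𝒦.Y (𝒦.Y a b i) 𝒦.one j := by
  obtain ⟨k, hk⟩ := 𝒦.weak_assoc a b 𝒦.one
  exact eq_of_mulAddPow_eq (substAdd02_of_neg (𝒦.Y_Y_one_of_neg a b))
    (fun m n hn => 𝒦.creation_reg _ n hn) hk i j

lemma sum_smul_Y_Y_one_eq_zero {ι : Type*} (s : Finset ι) (c : ι → ℂ) (a b : ι → K)
    (h : ∀ n, ∑ j ∈ s, c j • 𝒦.Y (a j) (b j) n = 0) (m n : ℤ) :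
    ∑ j ∈ s, c j • 𝒦.Y (a j) (𝒦.Y (b j) 𝒦.one n) m = 0 := by
  have hA := fun j => 𝒦.Y_Y_one_of_neg (a j) (b j)
  refine eq_zero_of_substAdd02_eq_zero (A := fun m n =>
    ∑ j ∈ s, c j • 𝒦.Y (a j) (𝒦.Y (b j) 𝒦.one n) m)
    (fun m n hn => Finset.sum_eq_zero fun j _ => by rw [hA j m n hn, smul_zero])
    (fun m n => ?_) m n
  rw [substAdd02_sum_smul s c hA]
  simp_rw [assoc_one]
  have := congrArg (fun x => 𝒦.Y x 𝒦.one n) (h m)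
  simpa using this

lemma finsum_single_smul_prodY_two (c : ℂ) (a b : K) (k : Fin 2 → ℤ) :
    (∑ᶠ L : Fin 2 → ℤ, (Pi.single (0 : Fin 2 → ℤ) c : (Fin 2 → ℤ) → ℂ) L •
      𝒦.prodY 2 ![a, b] fun i => k i - L i) = c • 𝒦.Y a (𝒦.Y b 𝒦.one (k 1)) (k 0) := by
  rw [finsum_eq_single _ 0 fun L hL => by rw [Pi.single_eq_of_ne hL, zero_smul]]
  simp [prodY]

lemma NonDegenerate.injective_lift_Y {𝒦 : NLVA K} (h𝒦 : 𝒦.NonDegenerate) :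
    Function.Injective (TensorProduct.lift 𝒦.Y) := by
  rw [← LinearMap.ker_eq_bot, LinearMap.ker_eq_bot']
  intro t ht
  let B := Module.Basis.ofVectorSpace ℂ K
  let BB := B.tensorProduct B
  let s := (BB.repr t).support
  let e := s.equivFin
  let p := fun j : Fin s.card => (e.symm j).1
  have hli : LinearIndependent ℂ fun j => B (p j).1 ⊗ₜ[ℂ] B (p j).2 := by
    have := BB.linearIndependent.comp p (Subtype.val_injective.comp e.symm.injective)
    simpa [BB, Function.comp_def, Module.Basis.tensorProduct_apply'] using this
  have hsum : ∑ j, BB.repr t (p j) • (B (p j).1 ⊗ₜ[ℂ] B (p j).2) = t := by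
    rw [e.symm.sum_comp fun q : s => BB.repr t q • (B q.1.1 ⊗ₜ[ℂ] B q.1.2),
      Finset.sum_coe_sort s fun q => BB.repr t q • (B q.1 ⊗ₜ[ℂ] B q.2)]
    conv_rhs => rw [← BB.linearCombination_repr t]
    simp [Finsupp.linearCombination_apply, Finsupp.sum, BB, s,
      Module.Basis.tensorProduct_apply']
  have hY : ∀ n, ∑ j, BB.repr t (p j) • 𝒦.Y (B (p j).1) (B (p j).2) n = 0 := by
    intro n
    rw [← hsum] at ht
    simp only [map_sum, map_smul, TensorProduct.lift.tmul] at ht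
    simpa using congrFun ht n
  have hf := h𝒦 2 two_pos s.card (fun j => ![B (p j).1, B (p j).2])
    (fun j => Pi.single 0 (BB.repr t (p j))) (fun j => isIterLaurent_two_single _)
    (linearIndependent_tprod_pair hli) fun k => by
      simp_rw [finsum_single_smul_prodY_two]
      exact 𝒦.sum_smul_Y_Y_one_eq_zero _ _ _ _ hY _ _
  rw [← hsum]
  refine Finset.sum_eq_zero fun j _ => ?_
  rw [Pi.single_eq_zero_iff.mp (hf j), zero_smul]

end NLVA

/-- In any nonlocal vertex algebra,
`Y(a,x₀+x₂)Y(b,x₂)𝟙 = Y(Y(a,x₀)b,x₂)𝟙` holds without any multiplier; hence if `K`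
is non-degenerate, the map `Y(x) : K ⊗ K → K((x))` is injective. -/
theorem statement_19 {K : Type*} [AddCommGroup K] [Module ℂ K] (𝒦 : NLVA K) :
    (∀ (a b : K) (i j : ℤ),
      substAdd02 (fun m n => 𝒦.Y a (𝒦.Y b 𝒦.one n) m) i j
        = 𝒦.Y (𝒦.Y a b i) 𝒦.one j) ∧
    (𝒦.NonDegenerate → Function.Injective (TensorProduct.lift 𝒦.Y)) := by
  exact ⟨𝒦.assoc_one, fun h => h.injective_lift_Y⟩
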